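/- Let n ≥ 1, r ≥ 1 be integers and let b be a nondecreasing parking function of length n with m(b) = m connected factors. Then the number of nondecreasing words (a_1,…,a_n), with 1 ≤ a_1 ≤ … ≤ a_n and a_i ≤ i + r − 1 for all i, whose parkization Park(a) equals b, is the binomial coefficient C(r−1+m, m). (The preimages are obtained by shifting the m connected factors of b by nonnegative amounts k_1,…,k_m with k_1 + ⋯ + k_m ≤ r−1.) -/

import Mathlib

open Finset

/-- `f : Fin n → ℕ` (a word over the positive integers, letters taken at face
value) is a parking function: all letters are at least `1` and the
nondecreasing rearrangement `f ∘ Tuple.sort f` satisfies `a↑ᵢ ≤ i`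
(1-based indexing). -/
def IsParkingWord {n : ℕ} (f : Fin n → ℕ) : Prop :=
  (∀ i, 1 ≤ f i) ∧ ∀ i : Fin n, (f ∘ Tuple.sort f) i ≤ (i : ℕ) + 1

open scoped Classical in
/-- One step of the parkization algorithm: if `f` is not yet a parking
function, choose the smallest `d ≥ 1` with `#{j : f j ≤ d} < d` and decrease
by `1` every letter greater than `d`. -/
noncomputable def parkStep {n : ℕ} (f : Fin n → ℕ) : Fin n → ℕ :=
  if IsParkingWord f then f
  else if h : ∃ d, 1 ≤ d ∧ (Finset.univ.filter fun j => f j ≤ d).card < d then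
    fun j => if Nat.find h < f j then f j - 1 else f j
  else f

/-- The parkization `Park(a)` of a word: iterate the elementary step until a
parking function is reached (iterating `∑ f i` times certainly suffices, since
each nontrivial step strictly decreases the sum of the letters, and parking
functions are fixed points). -/
noncomputable def park {n : ℕ} (f : Fin n → ℕ) : Fin n → ℕ :=
  parkStep^[∑ i, f i] f

open scoped Classical in
/-- `m(b)`: the number of connected factors of a nondecreasing parking
function `b`, i.e. `#{j ∈ {0,…,n-1} : b_{j+1} = j + 1}` (0-indexed `j`). -/
noncomputable def numFactors {n : ℕ} (b : Fin n → ℕ) : ℕ :=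
  (Finset.univ.filter fun j : Fin n => b j = (j : ℕ) + 1).card

/-- `a` arises from `b` by shifting the connected factors of `b` to the right by nondecreasing
amounts: `a - b` is nonnegative, nondecreasing, and can only jump at the first letter of a factor. -/
def IsFactorShift {n : ℕ} (a b : Fin n → ℕ) : Prop :=
  (∀ i, b i ≤ a i) ∧ (∀ i j, i ≤ j → a i + b j ≤ a j + b i) ∧
    ∀ i j : Fin n, (j : ℕ) + 1 = i → b i ≠ (i : ℕ) + 1 → a i + b j = a j + b i

lemma isParkingWord_iff_of_monotone {n : ℕ} {f : Fin n → ℕ} (hf : Monotone f) :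
    IsParkingWord f ↔ (∀ i, 1 ≤ f i) ∧ ∀ i : Fin n, f i ≤ (i : ℕ) + 1 := by
  rw [IsParkingWord, Tuple.sort_eq_refl_iff_monotone.2 hf]
  rfl

/-- On a nondecreasing word that is not a parking function, a step of the parkization algorithm
decreases by `1` the letters from the first position `p` (0-indexed) with letter above `p + 1`. -/
lemma exists_parkStep_eq {n : ℕ} {f : Fin n → ℕ} (hf : Monotone f) (hpos : ∀ i, 1 ≤ f i)
    (hnp : ¬ IsParkingWord f) :
    ∃ p : Fin n, (p : ℕ) + 1 < f p ∧ (∀ j < p, f j ≤ (j : ℕ) + 1) ∧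
      parkStep f = fun j => if p ≤ j then f j - 1 else f j := by
  classical
  have hex : ∃ i : Fin n, (i : ℕ) + 1 < f i := by
    by_contra! h
    exact hnp ((isParkingWord_iff_of_monotone hf).2 ⟨hpos, h⟩)
  have hcard : ∀ (d : ℕ) (i : Fin n),
      (i : ℕ) < (Finset.univ.filter fun j => f j ≤ d).card ↔ f i ≤ d :=
    fun d i => Tuple.lt_card_le_iff_apply_le_of_monotone hf
  have hd : ∃ d, 1 ≤ d ∧ (Finset.univ.filter fun j => f j ≤ d).card < d := by
    obtain ⟨i, hi⟩ := hex
    refine ⟨i + 1, by omega, ?_⟩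
    have := hcard (i + 1) i
    omega
  obtain ⟨hd1, hd2⟩ := Nat.find_spec hd
  have hmin : ∀ e, 1 ≤ e → e < Nat.find hd →
      e ≤ (Finset.univ.filter fun j => f j ≤ e).card := by
    intro e he hlt
    have := Nat.find_min hd hlt
    omega
  have hstep : parkStep f = fun j => if Nat.find hd < f j then f j - 1 else f j := by
    rw [parkStep, if_neg hnp, dif_pos]
  generalize Nat.find hd = d at hd1 hd2 hmin hstep
  have hbelow : ∀ j : Fin n, (j : ℕ) + 1 < d → f j ≤ (j : ℕ) + 1 := fun j hj =>
    (hcard _ j).1 (hmin _ (by omega) hj)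
  have hdn : d - 1 < n := by
    obtain ⟨i, hi⟩ := hex
    by_contra! h
    have := hbelow i
    omega
  have habove : d < f ⟨d - 1, hdn⟩ := by
    have := hcard d ⟨d - 1, hdn⟩
    simp only at this
    omega
  refine ⟨⟨d - 1, hdn⟩, by simp only; omega, fun j hj => hbelow j ?_, ?_⟩
  · have : (j : ℕ) < d - 1 := hj
    omega
  · rw [hstep]
    funext j
    congr 1
    refine propext ⟨fun h => ?_, fun h => habove.trans_le (hf h)⟩
    by_contra! hj
    have hj' : (j : ℕ) < d - 1 := hj
    have := hbelow j (by omega)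
    omega

lemma isFactorShift_iff_eq_of_le {n : ℕ} {a b : Fin n → ℕ} (ha : ∀ i : Fin n, a i ≤ (i : ℕ) + 1)
    (hb_pos : ∀ i, 1 ≤ b i) : IsFactorShift a b ↔ a = b := by
  constructor
  · rintro ⟨h1, -, h3⟩
    have key : ∀ k (hk : k < n), a ⟨k, hk⟩ = b ⟨k, hk⟩ := by
      intro k
      induction k with
      | zero =>
        intro hk
        have := ha ⟨0, hk⟩
        have := h1 ⟨0, hk⟩
        have := hb_pos ⟨0, hk⟩
        simp only at *
        omega
      | succ k ih =>
        intro hk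
        have e1 := ha ⟨k + 1, hk⟩
        have e2 := h1 ⟨k + 1, hk⟩
        have e3 := h3 ⟨k + 1, hk⟩ ⟨k, by omega⟩ rfl
        have e4 := ih (by omega)
        simp only at *
        by_cases h : b ⟨k + 1, hk⟩ = k + 1 + 1
        · omega
        · have := e3 h
          omega
    exact funext fun i => key i i.2
  · rintro rfl
    exact ⟨fun _ => le_rfl, fun _ _ _ => by omega, fun _ _ _ _ => by omega⟩

lemma isFactorShift_sub_one_iff {n : ℕ} {a b : Fin n → ℕ} {p : Fin n}
    (ha : Monotone a) (hp : (p : ℕ) + 1 < a p) (hlt : ∀ j < p, a j ≤ (j : ℕ) + 1)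
    (hb_pos : ∀ i, 1 ≤ b i) (hb_park : ∀ i : Fin n, b i ≤ (i : ℕ) + 1) :
    IsFactorShift (fun j => if p ≤ j then a j - 1 else a j) b ↔ IsFactorShift a b := by
  -- before `p`, both words agree with `b`
  have hzero : ∀ a' : Fin n → ℕ, (∀ j < p, a' j ≤ (j : ℕ) + 1) → IsFactorShift a' b →
      ∀ k (hk : k < n), k < (p : ℕ) → a' ⟨k, hk⟩ = b ⟨k, hk⟩ := by
    rintro a' hle ⟨h1, -, h3⟩ k
    induction k with
    | zero =>
      intro hk hkp
      have := hle ⟨0, hk⟩ hkp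
      have := h1 ⟨0, hk⟩
      have := hb_pos ⟨0, hk⟩
      simp only at *
      omega
    | succ k ih =>
      intro hk hkp
      have e1 := hle ⟨k + 1, hk⟩ hkp
      have e2 := h1 ⟨k + 1, hk⟩
      have e3 := h3 ⟨k + 1, hk⟩ ⟨k, by omega⟩ rfl
      have e4 := ih (by omega) (by omega)
      simp only at *
      by_cases h : b ⟨k + 1, hk⟩ = k + 1 + 1
      · omega
      · have := e3 h
        omega
  have hstart : ∀ a' : Fin n → ℕ, (∀ j < p, a' j ≤ (j : ℕ) + 1) → (p : ℕ) + 1 ≤ a' p →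
      IsFactorShift a' b → b p = (p : ℕ) + 1 := by
    intro a' hle hp' h
    by_contra hne
    have hbp := hb_park p
    have hbp' := hb_pos p
    have h0 : 0 < (p : ℕ) := by omega
    have e := h.2.2 p ⟨p - 1, by omega⟩ (by simp only; omega) hne
    have e' := hzero a' hle h (p - 1) (by omega) (by omega)
    omega
  have hapos : ∀ j, p ≤ j → 1 ≤ a j := fun j hj => by
    have := ha hj
    omega
  have hlt' : ∀ j < p, (if p ≤ j then a j - 1 else a j) ≤ (j : ℕ) + 1 := fun j hj => by
    rw [if_neg (not_le.2 hj)]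
    exact hlt j hj
  constructor
  · intro h
    have hs := hstart _ hlt' (by simp only [le_refl, if_true]; omega) h
    obtain ⟨h1, h2, h3⟩ := h
    refine ⟨fun i => ?_, fun i j hij => ?_, fun i j hij hi => ?_⟩
    · have := h1 i
      grind
    · have := h2 i j hij
      have := hapos i
      have := hapos j
      grind
    · have := h3 i j hij hi
      have := hapos i
      have := hapos j
      have : i ≠ p := by rintro rfl; exact hi hs
      have : p ≤ i ↔ p ≤ j := by
        simp only [Fin.le_def, ne_eq, Fin.ext_iff] at *
        omega
      grind
  · intro h
    have hs := hstart a hlt (by omega) h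
    have hz := hzero a hlt h
    obtain ⟨h1, h2, h3⟩ := h
    have hgt : ∀ j, p ≤ j → b j + 1 ≤ a j := fun j hj => by
      have := h2 p j hj
      omega
    refine ⟨fun i => ?_, fun i j hij => ?_, fun i j hij hi => ?_⟩
    · have := h1 i
      have := hgt i
      grind
    · have := h2 i j hij
      have := hgt i
      have := hgt j
      have := hz i i.2
      simp only [Fin.le_def, Fin.eta] at *
      split_ifs <;> grind
    · have := h3 i j hij hi
      have := hgt i
      have := hgt j
      have : i ≠ p := by rintro rfl; exact hi hs
      have : p ≤ i ↔ p ≤ j := by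
        simp only [Fin.le_def, ne_eq, Fin.ext_iff] at *
        omega
      grind

lemma parkStep_iterate_eq_iff {n : ℕ} {b : Fin n → ℕ} (hb_pos : ∀ i, 1 ≤ b i)
    (hb_park : ∀ i : Fin n, b i ≤ (i : ℕ) + 1) (N : ℕ) (a : Fin n → ℕ) (ha : Monotone a)
    (hpos : ∀ i, 1 ≤ a i) (hN : ∑ i, a i ≤ N) : parkStep^[N] a = b ↔ IsFactorShift a b := by
  induction N generalizing a with
  | zero =>
    have : ∀ i, a i ≤ (i : ℕ) + 1 := fun i =>
      ((Finset.single_le_sum (fun _ _ => Nat.zero_le _) (Finset.mem_univ i)).trans hN).trans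
        (Nat.zero_le _)
    exact (isFactorShift_iff_eq_of_le this hb_pos).symm
  | succ N ih =>
    by_cases hpk : IsParkingWord a
    · have hfix : parkStep a = a := by rw [parkStep, if_pos hpk]
      rw [Function.iterate_fixed hfix]
      exact (isFactorShift_iff_eq_of_le ((isParkingWord_iff_of_monotone ha).1 hpk).2 hb_pos).symm
    · obtain ⟨p, hp, hlt, hstep⟩ := exists_parkStep_eq ha hpos hpk
      have hgt : ∀ j, p ≤ j → (p : ℕ) + 1 < a j := fun j hj => hp.trans_le (ha hj)
      rw [Function.iterate_succ_apply, hstep, ← isFactorShift_sub_one_iff ha hp hlt hb_pos hb_park]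
      refine ih _ (fun i j hij => ?_) (fun i => ?_) ?_
      · have := ha hij
        have := hlt i
        have := hgt j
        simp only [Fin.le_def, Fin.lt_def] at *
        split_ifs <;> omega
      · have := hpos i
        have := hgt i
        grind
      · refine Nat.le_of_lt_succ (lt_of_lt_of_le (Finset.sum_lt_sum (fun i _ => ?_)
          ⟨p, Finset.mem_univ p, ?_⟩) hN)
        · split_ifs <;> omega
        · simp only [le_refl, if_true]
          omega

lemma park_eq_iff {n : ℕ} {a b : Fin n → ℕ} (ha : Monotone a) (hpos : ∀ i, 1 ≤ a i)
    (hb_pos : ∀ i, 1 ≤ b i) (hb_park : ∀ i : Fin n, b i ≤ (i : ℕ) + 1) :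
    park a = b ↔ IsFactorShift a b :=
  parkStep_iterate_eq_iff hb_pos hb_park _ a ha hpos le_rfl

open scoped Classical in
/-- The positions (0-indexed) at which the factors of `b` start, together with `n`. -/
noncomputable def factorCuts {n : ℕ} (b : Fin n → ℕ) : Finset ℕ :=
  insert n ((Finset.univ.filter fun j : Fin n => b j = (j : ℕ) + 1).map Fin.valEmbedding)

lemma mem_factorCuts {n : ℕ} {b : Fin n → ℕ} {k : ℕ} :
    k ∈ factorCuts b ↔ k = n ∨ ∃ h : k < n, b ⟨k, h⟩ = k + 1 := by
  simp only [factorCuts, Finset.mem_insert, Finset.mem_map, Finset.mem_filter, Finset.mem_univ,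
    true_and, Fin.valEmbedding_apply]
  refine or_congr_right ⟨?_, fun ⟨h, hb⟩ => ⟨⟨k, h⟩, hb, rfl⟩⟩
  rintro ⟨j, hj, rfl⟩
  exact ⟨j.2, hj⟩

lemma factorCuts_subset_range {n : ℕ} (b : Fin n → ℕ) : factorCuts b ⊆ Finset.range (n + 1) := by
  intro k hk
  rw [Finset.mem_range]
  rcases mem_factorCuts.1 hk with h | ⟨h, -⟩ <;> omega

lemma card_factorCuts {n : ℕ} (b : Fin n → ℕ) : (factorCuts b).card = numFactors b + 1 := by
  rw [factorCuts, Finset.card_insert_of_notMem, Finset.card_map, numFactors]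
  simp only [Finset.mem_map, Fin.valEmbedding_apply, not_exists, not_and]
  exact fun j _ => j.2.ne

/-- The word obtained from `b` by shifting its letters by the partial sums of `k`. -/
def shiftWord {n : ℕ} (b : Fin n → ℕ) (k : ℕ →₀ ℕ) (i : Fin n) : ℕ :=
  b i + ∑ j ∈ Finset.range (i + 1), k j

lemma sum_range_of_mem_finsuppAntidiag {n q : ℕ} {b : Fin n → ℕ} {k : ℕ →₀ ℕ}
    (hk : k ∈ (factorCuts b).finsuppAntidiag q) : ∑ j ∈ Finset.range (n + 1), k j = q := by
  rw [Finset.mem_finsuppAntidiag] at hk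
  rw [← hk.1]
  refine (Finset.sum_subset (factorCuts_subset_range b) fun j _ hj => ?_).symm
  exact Finsupp.notMem_support_iff.1 fun h => hj (hk.2 h)

lemma shiftWord_injOn {n : ℕ} (b : Fin n → ℕ) (q : ℕ) :
    Set.InjOn (shiftWord b) ((factorCuts b).finsuppAntidiag q : Finset (ℕ →₀ ℕ)) := by
  intro k hk l hl hkl
  have hsum : ∀ i ≤ n + 1, ∑ j ∈ Finset.range i, k j = ∑ j ∈ Finset.range i, l j := by
    intro i hi
    rcases Nat.eq_zero_or_pos i with rfl | h0
    · simp
    rcases hi.eq_or_lt with rfl | hi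
    · rw [sum_range_of_mem_finsuppAntidiag hk, sum_range_of_mem_finsuppAntidiag hl]
    · have := congrFun hkl ⟨i - 1, by omega⟩
      simpa [shiftWord, Nat.sub_add_cancel h0] using this
  have hout : ∀ k ∈ (factorCuts b).finsuppAntidiag q, ∀ i, n + 1 ≤ i → k i = 0 := by
    intro k hk i hi
    refine Finsupp.notMem_support_iff.1 fun h => ?_
    have := factorCuts_subset_range b ((Finset.mem_finsuppAntidiag.1 hk).2 h)
    rw [Finset.mem_range] at this
    omega
  ext i
  rcases lt_or_ge i (n + 1) with hi | hi
  · have e := hsum (i + 1) hi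
    rw [Finset.sum_range_succ, Finset.sum_range_succ, hsum i hi.le] at e
    omega
  · rw [hout k hk i hi, hout l hl i hi]

lemma shiftWord_image {n : ℕ} {b : Fin n → ℕ} (hb_mono : Monotone b) (hb_pos : ∀ i, 1 ≤ b i)
    (hb_park : ∀ i : Fin n, b i ≤ (i : ℕ) + 1) (q : ℕ) :
    shiftWord b '' ((factorCuts b).finsuppAntidiag q : Finset (ℕ →₀ ℕ)) =
      {a | Monotone a ∧ (∀ i, 1 ≤ a i) ∧ (∀ i : Fin n, a i ≤ (i : ℕ) + 1 + q) ∧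
        IsFactorShift a b} := by
  ext a
  constructor
  · rintro ⟨k, hk, rfl⟩
    have hmono : Monotone fun i => ∑ j ∈ Finset.range i, k j := fun i j hij =>
      Finset.sum_le_sum_of_subset (Finset.range_mono hij)
    have hle : ∀ i : Fin n, ∑ j ∈ Finset.range (i + 1), k j ≤ q := fun i => by
      rw [← sum_range_of_mem_finsuppAntidiag hk]
      exact hmono (by omega)
    have hmono' : ∀ i j : Fin n, i ≤ j →
        ∑ t ∈ Finset.range (i + 1), k t ≤ ∑ t ∈ Finset.range (j + 1), k t := fun i j hij =>
      hmono (Nat.succ_le_succ hij)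
    refine ⟨fun i j hij => add_le_add (hb_mono hij) (hmono' i j hij),
      fun i => (hb_pos i).trans (Nat.le_add_right _ _),
      fun i => add_le_add (hb_park i) (hle i),
      fun i => Nat.le_add_right _ _, fun i j hij => ?_, fun i j hij hi => ?_⟩
    · have := hmono' i j hij
      simp only [shiftWord]
      omega
    · have hki : k i = 0 := by
        refine Finsupp.notMem_support_iff.1 fun h => ?_
        rcases mem_factorCuts.1 ((Finset.mem_finsuppAntidiag.1 hk).2 h) with h' | ⟨_, h'⟩
        · exact i.2.ne h'
        · exact hi h'
      simp only [shiftWord]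
      rw [Finset.sum_range_succ _ (i : ℕ), hki, ← hij]
      omega
  · rintro ⟨-, -, hq, h1, h2, h3⟩
    -- the shift on each factor is at most `q`
    have hcq : ∀ k (hk : k < n), a ⟨k, hk⟩ ≤ b ⟨k, hk⟩ + q := by
      intro k
      induction k with
      | zero =>
        intro hk
        have := hq ⟨0, hk⟩
        have := hb_pos ⟨0, hk⟩
        simp only at *
        omega
      | succ k ih =>
        intro hk
        have e1 := hq ⟨k + 1, hk⟩
        have e3 := h3 ⟨k + 1, hk⟩ ⟨k, by omega⟩ rfl
        have e4 := ih (by omega)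
        simp only at *
        by_cases h : b ⟨k + 1, hk⟩ = k + 1 + 1
        · omega
        · have := e3 h
          omega
    let C : ℕ → ℕ := fun i =>
      if i = 0 then 0 else if h : i - 1 < n then a ⟨i - 1, h⟩ - b ⟨i - 1, h⟩ else q
    have hC0 : C 0 = 0 := rfl
    have hC1 : ∀ i (h : i < n), C (i + 1) = a ⟨i, h⟩ - b ⟨i, h⟩ := fun i h => by
      simp [C, h]
    have hC2 : ∀ i, n < i → C i = q := fun i h => by
      simp only [C]
      rw [if_neg (by omega), dif_neg (by omega)]
    have hCmono : Monotone C := by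
      refine monotone_nat_of_le_succ fun i => ?_
      rcases i with _ | i
      · rw [hC0]
        exact Nat.zero_le _
      rcases lt_trichotomy (i + 1) n with h | h | h
      · rw [hC1 i (by omega), hC1 (i + 1) h]
        have := h1 ⟨i, by omega⟩
        have := h2 ⟨i, by omega⟩ ⟨i + 1, h⟩ (Nat.le_succ i)
        omega
      · rw [hC1 i (by omega), hC2 _ (by omega)]
        have := hcq i (by omega)
        omega
      · rw [hC2 _ h, hC2 _ (by omega)]
    have hsupp : ∀ j, C (j + 1) - C j ≠ 0 → j ∈ factorCuts b := by
      intro j hj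
      rw [mem_factorCuts]
      rcases lt_trichotomy j n with h | h | h
      · refine Or.inr ⟨h, ?_⟩
        by_contra hne
        rcases j with _ | j
        · have := hb_pos ⟨0, h⟩
          have := hb_park ⟨0, h⟩
          simp only at *
          omega
        · have := h3 ⟨j + 1, h⟩ ⟨j, by omega⟩ rfl hne
          rw [hC1 _ h, hC1 j (by omega)] at hj
          omega
      · exact Or.inl h
      · rw [hC2 _ h, hC2 _ (by omega)] at hj
        omega
    let k : ℕ →₀ ℕ := Finsupp.onFinset (factorCuts b) (fun j => C (j + 1) - C j) hsupp
    have hksum : ∀ i, ∑ j ∈ Finset.range i, k j = C i := fun i =>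
      (Finset.sum_range_tsub hCmono i).trans (by rw [hC0, Nat.sub_zero])
    refine ⟨k, ?_, ?_⟩
    · rw [Finset.mem_coe, Finset.mem_finsuppAntidiag]
      refine ⟨?_, Finsupp.support_onFinset_subset⟩
      rw [← hC2 (n + 1) (Nat.lt_succ_self n), ← hksum]
      exact Finset.sum_subset (factorCuts_subset_range b) fun j _ hj =>
        by_contra fun h => hj (hsupp j h)
    · funext i
      rw [shiftWord, hksum, hC1 i i.2]
      exact Nat.add_sub_of_le (h1 i)

theorem stmt13 (n r : ℕ) (hn : 1 ≤ n) (hr : 1 ≤ r) (b : Fin n → ℕ)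
    (hb_mono : Monotone b) (hb_pos : ∀ i, 1 ≤ b i)
    (hb_park : ∀ i : Fin n, b i ≤ (i : ℕ) + 1) :
    {a : Fin n → ℕ | Monotone a ∧ (∀ i, 1 ≤ a i) ∧
        (∀ i : Fin n, a i ≤ (i : ℕ) + r) ∧ park a = b}.ncard =
      (r - 1 + numFactors b).choose (numFactors b) := by
  have hset : {a : Fin n → ℕ | Monotone a ∧ (∀ i, 1 ≤ a i) ∧
        (∀ i : Fin n, a i ≤ (i : ℕ) + r) ∧ park a = b} =
      shiftWord b '' ((factorCuts b).finsuppAntidiag (r - 1) : Finset (ℕ →₀ ℕ)) := by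
    rw [shiftWord_image hb_mono hb_pos hb_park]
    ext a
    refine and_congr_right fun ha => and_congr_right fun hpos => and_congr ?_ ?_
    · refine forall_congr' fun i => ?_
      omega
    · exact park_eq_iff ha hpos hb_pos hb_park
  rw [hset, (shiftWord_injOn b _).ncard_image, Set.ncard_coe_finset,
    Finset.card_finsuppAntidiag_nat_eq_choose, card_factorCuts]
  rw [← Nat.choose_symm_add]
  congr 1
  omega
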